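/- Let λ be a pre-dominant integral weight for a finite crystallographic root system and d = |D(λ)|. Every λ-path has length at most d, every λ-path of length d consists of simple roots, and the sum over all maximal λ-paths (β_1, β_2, …, β_d) of the product (1/β_1)·(1/(β_1+β_2))·…·(1/(β_1+β_2+⋯+β_d)) equals ∏_{β ∈ D(λ)} (1/β). -/

import Mathlib

open scoped Classical BigOperators

/-- A bundled setting for a finite crystallographic root system together with its
Weyl group, its action on the rational span of the weight lattice, reflections,
and the data of coefficients of roots in the basis of simple roots. -/
structure WeylSetting where
  /-- index set of the Dynkin diagram (simple roots) -/
  I : Type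
  [fintypeI : Fintype I]
  [decEqI : DecidableEq I]
  /-- rational span of the weight lattice -/
  V : Type
  [acg : AddCommGroup V]
  [mod : Module ℚ V]
  /-- the Weyl group -/
  W : Type
  [grp : Group W]
  /-- the action of the Weyl group on weights -/
  act : W →* (V ≃ₗ[ℚ] V)
  /-- the simple roots -/
  simple : I → V
  /-- the (finite) set of roots -/
  roots : Finset V
  /-- `coroot β μ` is the pairing `⟨μ, β∨⟩` -/
  coroot : V → (V →ₗ[ℚ] ℚ)
  /-- the reflection `s_β ∈ W` associated to a root `β` -/
  srefl : V → W
  /-- coefficients of a positive root in the basis of simple roots -/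
  posCoeff : V → I → ℕ
  simple_mem : ∀ i, simple i ∈ roots
  simple_indep : LinearIndependent ℚ simple
  roots_neg : ∀ β ∈ roots, -β ∈ roots
  root_pos_or_neg : ∀ β ∈ roots,
    (∃ c : I → ℚ, (∀ i, 0 ≤ c i) ∧ β = ∑ i, c i • simple i) ∨
    (∃ c : I → ℚ, (∀ i, 0 ≤ c i) ∧ -β = ∑ i, c i • simple i)
  coroot_self : ∀ β ∈ roots, coroot β β = 2
  crystallographic : ∀ β ∈ roots, ∀ γ ∈ roots, ∃ n : ℤ, coroot β γ = n
  posCoeff_spec : ∀ β ∈ roots,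
    (∃ c : I → ℚ, (∀ i, 0 ≤ c i) ∧ β = ∑ i, c i • simple i) →
    β = ∑ i, (posCoeff β i : ℚ) • simple i
  srefl_apply : ∀ β ∈ roots, ∀ v : V, act (srefl β) v = v - coroot β v • β
  act_faithful : ∀ g : W, (∀ v : V, act g v = v) → g = 1
  roots_invariant : ∀ g : W, ∀ β ∈ roots, act g β ∈ roots
  coroot_equivariant : ∀ g : W, ∀ β ∈ roots, ∀ v : V,
    coroot (act g β) (act g v) = coroot β v
  generated : ∀ g : W, ∃ l : List I, g = (l.map fun i => srefl (simple i)).prod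

namespace WeylSetting

attribute [instance] fintypeI decEqI acg mod grp

variable (D : WeylSetting)

/-- the simple reflection attached to a node of the Dynkin diagram -/
def s (i : D.I) : D.W := D.srefl (D.simple i)

/-- the product `s_{i_1} ⋯ s_{i_r}` of the simple reflections listed in `l` -/
def wordProd (l : List D.I) : D.W := (l.map D.s).prod

/-- `β` is a positive root: a root which is a nonnegative combination of simple roots -/
def IsPosRoot (β : D.V) : Prop :=
  β ∈ D.roots ∧ ∃ c : D.I → ℚ, (∀ i, 0 ≤ c i) ∧ β = ∑ i, c i • D.simple i

/-- the length of a Weyl group element -/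
noncomputable def length (g : D.W) : ℕ :=
  sInf {n | ∃ l : List D.I, l.length = n ∧ D.wordProd l = g}

/-- `l` is a reduced word for `g` -/
def IsReduced (l : List D.I) (g : D.W) : Prop :=
  D.wordProd l = g ∧ l.length = D.length g

/-- the number of reduced words of `g` -/
noncomputable def RedCard (g : D.W) : ℕ := Nat.card {l : List D.I // D.IsReduced l g}

/-- the (strong) Bruhat order on the Weyl group -/
def bruhatLE : D.W → D.W → Prop :=
  Relation.ReflTransGen
    (fun a b => (∃ β, D.IsPosRoot β ∧ b = D.srefl β * a) ∧ D.length a < D.length b)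

/-- strict (strong) Bruhat order -/
def bruhatLT (a b : D.W) : Prop := D.bruhatLE a b ∧ a ≠ b

/-- the left weak Bruhat order: `a ≤_L b` iff `ℓ(b a⁻¹) + ℓ(a) = ℓ(b)` -/
def weakLE (a b : D.W) : Prop := D.length (b * a⁻¹) + D.length a = D.length b

/-- the height of a positive root: the sum of its coefficients in the simple roots -/
noncomputable def ht (β : D.V) : ℕ := ∑ i, D.posCoeff β i

/-- an integral weight: the pairings with all positive coroots are integers -/
def IsIntegral (lam : D.V) : Prop :=
  ∀ β, D.IsPosRoot β → ∃ n : ℤ, D.coroot β lam = n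

/-- a dominant integral weight -/
def IsDominant (lam : D.V) : Prop :=
  D.IsIntegral lam ∧ ∀ i, 0 ≤ D.coroot (D.simple i) lam

/-- a pre-dominant integral weight: `⟨λ, β∨⟩ ≥ -1` for all positive roots `β` -/
def IsPreDominant (lam : D.V) : Prop :=
  D.IsIntegral lam ∧ ∀ β, D.IsPosRoot β → -1 ≤ D.coroot β lam

/-- the diagram `D(λ) = {β ∈ R⁺ : ⟨λ, β∨⟩ = -1}` of a pre-dominant weight -/
noncomputable def diagram (lam : D.V) : Finset D.V :=
  D.roots.filter fun β => D.IsPosRoot β ∧ D.coroot β lam = -1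

/-- `IsWeightPath λ [β₁, …, β_r]` says that
`λ = λ₀ →β₁ λ₁ →β₂ ⋯ →β_r λ_r` is a `λ`-path, i.e. each `β_j` is a positive
root, `⟨λ_{j-1}, β_j∨⟩ = -1` and `λ_j = s_{β_j}(λ_{j-1})`. -/
def IsWeightPath : D.V → List D.V → Prop
  | _, [] => True
  | lam, β :: rest =>
      D.IsPosRoot β ∧ D.coroot β lam = -1 ∧
        IsWeightPath (D.act (D.srefl β) lam) rest

/-- the term `1/β₁ ⋅ 1/(β₁+β₂) ⋅ … ⋅ 1/(β₁+⋯+β_r)` attached to a path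
`(β₁, …, β_r)`, computed in a field `F` via a linear embedding `emb`. -/
noncomputable def pathTerm {F : Type} [Field F] [Algebra ℚ F]
    (emb : D.V →ₗ[ℚ] F) (l : List D.V) : F :=
  ∏ j ∈ Finset.range l.length, (emb ((l.take (j + 1)).sum))⁻¹

/-- `w` is a π-minuscule element (in the sense of Peterson). -/
def IsMinuscule (pi : D.V) (w : D.W) : Prop :=
  ∃ l : List D.I, D.IsReduced l w ∧
    ∀ k : Fin l.length,
      D.coroot (D.simple (l.get k)) (D.act (D.wordProd (l.drop (k.val + 1))) pi) = 1

/-- the stabilizer `W_π = Stab_W(π)` of a weight -/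
def stab (pi : D.V) : Subgroup D.W where
  carrier := {g | D.act g pi = pi}
  one_mem' := by simp
  mul_mem' := by
    intro a b ha hb
    simp only [Set.mem_setOf_eq] at *
    calc D.act (a * b) pi = D.act a (D.act b pi) := by rw [map_mul]; rfl
    _ = pi := by rw [hb, ha]
  inv_mem' := by
    intro a ha
    simp only [Set.mem_setOf_eq] at *
    calc D.act a⁻¹ pi = D.act a⁻¹ (D.act a pi) := by rw [ha]
    _ = D.act (a⁻¹ * a) pi := by rw [map_mul]; rfl
    _ = pi := by simp

/-- `u` is the minimal-length representative of its coset `uH` -/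
def IsMinRep (H : Subgroup D.W) (u : D.W) : Prop :=
  ∀ g : D.W, u⁻¹ * g ∈ H → D.length u ≤ D.length g

/-- `a` and `b` lie in the same coset of `H`, i.e. `aH = bH` -/
def SameCoset (H : Subgroup D.W) (a b : D.W) : Prop := a⁻¹ * b ∈ H

/-- `u →β w` in `W^P`: `β` is a positive root, `u, w` are minimal-length
representatives, `s_β w H = u H`, and `u < w` in Bruhat order -/
def Arrow (H : Subgroup D.W) (u w : D.W) (β : D.V) : Prop :=
  D.IsPosRoot β ∧ D.IsMinRep H u ∧ D.IsMinRep H w ∧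
    D.SameCoset H (D.srefl β * w) u ∧ D.bruhatLT u w

/-- `ArrowPath H w [β₁, …, β_r]` encodes a directed path
`x_r →β_r ⋯ → x_1 →β₁ x_0 = w` in the Bruhat graph on `W^P`. -/
def ArrowPath (H : Subgroup D.W) : D.W → List D.V → Prop
  | _, [] => True
  | w, β :: rest => ∃ u, D.Arrow H u w β ∧ ArrowPath H u rest

/-- directed paths as above whose vertices all lie above `v` in Bruhat order -/
def ArrowPathGE (H : Subgroup D.W) (v : D.W) : D.W → List D.V → Prop
  | _, [] => True
  | w, β :: rest => ∃ u, D.Arrow H u w β ∧ D.bruhatLE v u ∧ ArrowPathGE H v u rest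

/-- directed paths from `u` to `w`:
`u = x_r →β_r ⋯ → x_1 →β₁ x_0 = w` encoded by the list `[β₁, …, β_r]`. -/
def ArrowPathFromTo (H : Subgroup D.W) (u : D.W) : D.W → List D.V → Prop
  | w, [] => u = w
  | w, β :: rest => ∃ x, D.Arrow H x w β ∧ ArrowPathFromTo H u x rest

/-- `S(w) = {β ∈ R⁺ : s_β w < w}` -/
noncomputable def Sset (w : D.W) : Finset D.V :=
  D.roots.filter fun β => D.IsPosRoot β ∧ D.bruhatLT (D.srefl β * w) w

/-- `S(w/v) = {β ∈ R⁺ : v ≤ s_β w < w}` -/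
noncomputable def SsetSkew (v w : D.W) : Finset D.V :=
  D.roots.filter fun β =>
    D.IsPosRoot β ∧ D.bruhatLE v (D.srefl β * w) ∧ D.bruhatLT (D.srefl β * w) w

/-- an oriented edge `x → y` in the Bruhat graph of `G/P`: `x, y` are minimal
representatives, `xH < yH`, and `yH = x s_γ H` for some positive root `γ` -/
def GEdge (H : Subgroup D.W) (x y : D.W) : Prop :=
  D.IsMinRep H x ∧ D.IsMinRep H y ∧ D.bruhatLT x y ∧
    ∃ γ, D.IsPosRoot γ ∧ D.SameCoset H (x * D.srefl γ) y

/-- the (unique) positive root `γ` with `yH = x s_γ H` attached to an edge -/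
noncomputable def edgeRoot (H : Subgroup D.W) (x y : D.W) : D.V :=
  if h : ∃ γ, D.IsPosRoot γ ∧ D.SameCoset H (x * D.srefl γ) y then h.choose else 0

/-- `GChainTo H v t [x₁, …, x_r]` encodes a directed path
`v ≤ x_r → ⋯ → x_1 → x_0 = t` in the Bruhat graph of `G/P` -/
def GChainTo (H : Subgroup D.W) (v : D.W) : D.W → List D.W → Prop
  | _, [] => True
  | t, x :: rest => D.GEdge H x t ∧ D.bruhatLE v x ∧ GChainTo H v x rest

/-- the weighted term
`(m_Λ(x_r,x_{r-1})/W_Λ(x_r)) ⋯ (m_Λ(x_1,x_0)/W_Λ(x_1))` of a path in the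
`Λ`-Bruhat graph, computed in a field `F` via a linear embedding `emb`. -/
noncomputable def chainTerm {F : Type} [Field F] [Algebra ℚ F]
    (emb : D.V →ₗ[ℚ] F) (H : Subgroup D.W) (Lam : D.W → D.V) (w : D.W) :
    D.W → List D.W → F
  | _, [] => 1
  | t, x :: rest =>
      algebraMap ℚ F (D.coroot (D.edgeRoot H x t) (Lam x)) *
        (emb (D.act x (Lam x) - D.act w (Lam x)))⁻¹ *
        chainTerm emb H Lam w x rest

/-- the Bruhat order on cosets: `aH ≤ bH` -/
def cosetLE (H : Subgroup D.W) (a b : D.W) : Prop :=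
  ∃ x y, D.SameCoset H a x ∧ D.SameCoset H b y ∧ D.bruhatLE x y

/-- the (standard) parabolic subgroup generated by simple reflections in `J` -/
def parab (J : Set D.I) : Subgroup D.W := Subgroup.closure (D.s '' J)

/-- `X*(T)_P`: integral weights orthogonal to all coroots of `W_P`,
i.e. to `γ∨` for all positive roots `γ` in the span of the simple roots of `P` -/
def OrthWeightP (J : Set D.I) (lam : D.V) : Prop :=
  D.IsIntegral lam ∧
    ∀ γ, D.IsPosRoot γ → γ ∈ Submodule.span ℚ (D.simple '' J) → D.coroot γ lam = 0

/-- an admissible function `Λ : [v,w]^P → X*(T)_P` -/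
def Admissible (J : Set D.I) (v w : D.W) (Lam : D.W → D.V) : Prop :=
  (∀ x, D.IsMinRep (D.parab J) x → D.bruhatLE v x → D.bruhatLE x w →
      D.OrthWeightP J (Lam x)) ∧
  (∀ x, D.IsMinRep (D.parab J) x → D.bruhatLE v x → D.bruhatLE x w → x ≠ w →
      D.act x (Lam x) ≠ D.act w (Lam x))

/-- the subword of `l` with letters at the positions in `S`, in increasing order -/
def subwordF (l : List D.I) (S : Finset (Fin l.length)) : List D.I :=
  ((List.finRange l.length).filter fun j => j ∈ S).map l.get

/-- `β_j = s_{i_1} ⋯ s_{i_{j-1}}(α_{i_j})` attached to a reduced word `l` -/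
noncomputable def refRoot (l : List D.I) (j : Fin l.length) : D.V :=
  D.act (D.wordProd (l.take j.val)) (D.simple (l.get j))

/-- the Weyl group is simply laced: the Cartan pairing is symmetric -/
def SimplyLaced : Prop :=
  ∀ i j, D.coroot (D.simple i) (D.simple j) = D.coroot (D.simple j) (D.simple i)

/-- generating relation of the heap order of the word `l`:
`p_j < p_k` whenever `j < k` and `s_{i_j}`, `s_{i_k}` do not commute -/
def heapCovers (l : List D.I) (j k : Fin l.length) : Prop :=
  (j : ℕ) < (k : ℕ) ∧ D.s (l.get j) * D.s (l.get k) ≠ D.s (l.get k) * D.s (l.get j)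

/-- the heap order of the word `l`: the minimal partial order generated by
`heapCovers` -/
def heapLE (l : List D.I) : Fin l.length → Fin l.length → Prop :=
  Relation.ReflTransGen (D.heapCovers l)

/-- strict heap order -/
def heapLT (l : List D.I) (j k : Fin l.length) : Prop := D.heapLE l j k ∧ j ≠ k

/-- `F` is an order filter of the heap `H(w)` of the word `l` -/
def IsHeapFilter (l : List D.I) (F : Finset (Fin l.length)) : Prop :=
  ∀ j k, j ∈ F → D.heapLE l j k → k ∈ F

/-- `i` and `j` are joined by an edge of the Dynkin diagram -/
def adjDynkin (i j : D.I) : Prop := i ≠ j ∧ D.s i * D.s j ≠ D.s j * D.s i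

/-- an elementary excitation `A ▷ B` of subsets of the heap of the word `l` -/
def Excite (l : List D.I) (A B : Finset (Fin l.length)) : Prop :=
  ∃ p q, D.heapLT l p q ∧ l.get p = l.get q ∧ q ∈ A ∧ p ∈ B ∧
    A.erase q = B.erase p ∧
    (∀ z, D.heapLT l p z → D.heapLT l z q → l.get z ≠ l.get p) ∧
    ∀ u ∈ A, D.heapLE l p u → D.heapLE l u q → ¬ D.adjDynkin (l.get p) (l.get u)

/-- `A` is an excited diagram of `F` in the heap of the word `l`,
i.e. `A ∈ E_{H(w)}(F)` -/
def InExcited (l : List D.I) (F A : Finset (Fin l.length)) : Prop :=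
  Relation.ReflTransGen (D.Excite l) F A

end WeylSetting
namespace WeylSetting

variable (D : WeylSetting)

theorem exists_coef : ∃ C : D.V →ₗ[ℚ] (D.I →₀ ℚ), ∀ i, C (D.simple i) = Finsupp.single i 1 := by
  obtain ⟨C, hC⟩ := LinearMap.exists_extend (D.simple_indep.repr : _ →ₗ[ℚ] _)
  refine ⟨C, fun i => ?_⟩
  have hm : D.simple i ∈ Submodule.span ℚ (Set.range D.simple) :=
    Submodule.subset_span ⟨i, rfl⟩
  have := LinearMap.congr_fun hC ⟨D.simple i, hm⟩
  simp only [LinearMap.comp_apply, Submodule.subtype_apply] at this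
  rw [this]
  exact D.simple_indep.repr_eq_single i _ rfl

/-- coordinates with respect to the simple roots -/
noncomputable def coef : D.V →ₗ[ℚ] (D.I →₀ ℚ) := D.exists_coef.choose

theorem coef_simple (i k : D.I) : D.coef (D.simple i) k = if i = k then 1 else 0 := by
  rw [coef, D.exists_coef.choose_spec, Finsupp.single_apply]

theorem coef_sum (c : D.I → ℚ) (k : D.I) : D.coef (∑ i, c i • D.simple i) k = c k := by
  simp [map_sum, Finsupp.finsetSum_apply, coef_simple]

theorem root_cases {β : D.V} (hβ : β ∈ D.roots) :
    D.IsPosRoot β ∨ ((∀ k, D.coef β k ≤ 0)) := by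
  rcases D.root_pos_or_neg β hβ with h | ⟨c, hc, h⟩
  · exact Or.inl ⟨hβ, h⟩
  · right
    intro k
    have := D.coef_sum c k
    rw [← h, map_neg, Finsupp.neg_apply] at this
    have := hc k
    linarith

theorem posRoot_eq {β : D.V} (hβ : D.IsPosRoot β) : β = ∑ i, D.coef β i • D.simple i := by
  obtain ⟨_, c, _, h⟩ := hβ
  have : ∀ k, D.coef β k = c k := fun k => by rw [h, coef_sum]
  simp only [this]; exact h

theorem posRoot_coef {β : D.V} (hβ : D.IsPosRoot β) (k : D.I) :
    ∃ n : ℕ, D.coef β k = n := by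
  refine ⟨D.posCoeff β k, ?_⟩
  have := D.posCoeff_spec β hβ.1 hβ.2
  conv_lhs => rw [this]
  rw [coef_sum]

theorem root_ne_zero {β : D.V} (hβ : β ∈ D.roots) : β ≠ 0 := by
  rintro rfl
  have := D.coroot_self _ hβ
  simp at this

theorem posRoot_simple (i : D.I) : D.IsPosRoot (D.simple i) :=
  ⟨D.simple_mem i, fun k => if k = i then 1 else 0, fun k => by dsimp only; split_ifs <;> norm_num, by simp⟩

/-- the height functional -/
noncomputable def hgt (v : D.V) : ℚ := ∑ k, D.coef v k

theorem hgt_add (u v : D.V) : D.hgt (u + v) = D.hgt u + D.hgt v := by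
  simp [hgt, Finset.sum_add_distrib]
theorem hgt_sub (u v : D.V) : D.hgt (u - v) = D.hgt u - D.hgt v := by
  simp [hgt]
theorem hgt_smul (c : ℚ) (v : D.V) : D.hgt (c • v) = c * D.hgt v := by
  simp [hgt, Finset.mul_sum]
theorem hgt_simple (i : D.I) : D.hgt (D.simple i) = 1 := by
  simp [hgt, coef_simple]

theorem hgt_pos {β : D.V} (hβ : D.IsPosRoot β) :
    1 ≤ D.hgt β ∧ (D.hgt β = 1 → ∃ i, β = D.simple i) := by
  choose n hn using D.posRoot_coef hβ
  have hs : D.hgt β = ((∑ k, n k : ℕ) : ℚ) := by simp [hgt, hn]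
  have hne : ∃ k, n k ≠ 0 := by
    by_contra hcon
    push Not at hcon
    apply D.root_ne_zero hβ.1
    rw [D.posRoot_eq hβ]
    simp [hn, hcon]
  obtain ⟨k, hk⟩ := hne
  have hle : n k ≤ ∑ k, n k := Finset.single_le_sum (f := n) (fun _ _ => Nat.zero_le _) (Finset.mem_univ k)
  refine ⟨?_, fun h1 => ⟨k, ?_⟩⟩
  · rw [hs]; exact_mod_cast (by omega : 1 ≤ ∑ k, n k)
  · rw [hs] at h1
    have h1' : ∑ k, n k = 1 := by exact_mod_cast h1
    have hsplit := Finset.add_sum_erase Finset.univ n (Finset.mem_univ k)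
    have h0 : ∑ x ∈ Finset.univ.erase k, n x = 0 := by omega
    have hk1 : n k = 1 := by omega
    have hz : ∀ j, j ≠ k → n j = 0 := fun j hj =>
      (Finset.sum_eq_zero_iff.1 h0) j (by simp [hj])
    rw [D.posRoot_eq hβ, Finset.sum_eq_single k]
    · simp [hn, hk1]
    · intro j _ hj; simp [hn, hz j hj]
    · simp

/-- the invariant form -/
noncomputable def form (u v : D.V) : ℚ := ∑ β ∈ D.roots, D.coroot β u * D.coroot β v

theorem act_inv (g : D.W) (v : D.V) : D.act g⁻¹ (D.act g v) = v := by
  rw [← LinearEquiv.mul_apply, ← map_mul]; simp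
theorem act_inv' (g : D.W) (v : D.V) : D.act g (D.act g⁻¹ v) = v := by
  rw [← LinearEquiv.mul_apply, ← map_mul]; simp

theorem form_inv (g : D.W) (u v : D.V) : D.form (D.act g u) (D.act g v) = D.form u v := by
  unfold form
  symm
  refine Finset.sum_nbij' (fun β => D.act g β) (fun β => D.act g⁻¹ β) ?_ ?_ ?_ ?_ ?_
  · intro β hβ; exact D.roots_invariant g β hβ
  · intro β hβ; exact D.roots_invariant _ β hβ
  · intro β _; exact D.act_inv g β
  · intro β _; exact D.act_inv' g β
  · intro β hβ
    rw [D.coroot_equivariant g β hβ, D.coroot_equivariant g β hβ]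

theorem form_sub_right (u v w : D.V) : D.form u (v - w) = D.form u v - D.form u w := by
  simp [form, mul_sub]
theorem form_smul_right (c : ℚ) (u v : D.V) : D.form u (c • v) = c * D.form u v := by
  simp only [form, map_smul, smul_eq_mul, Finset.mul_sum]
  exact Finset.sum_congr rfl fun _ _ => by ring
theorem form_comm (u v : D.V) : D.form u v = D.form v u := by
  simp [form, mul_comm]
theorem form_neg_left (u v : D.V) : D.form (-u) v = - D.form u v := by
  simp [form]
theorem form_sum_smul {c : D.I → ℚ} (v : D.V) :
    D.form (∑ i, c i • D.simple i) v = ∑ i, c i * D.form (D.simple i) v := by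
  simp only [form, map_sum, map_smul, smul_eq_mul, Finset.mul_sum, Finset.sum_mul]
  rw [Finset.sum_comm]
  exact Finset.sum_congr rfl fun _ _ => Finset.sum_congr rfl fun _ _ => by ring

theorem form_pos {γ : D.V} (hγ : γ ∈ D.roots) : 0 < D.form γ γ := by
  have : D.coroot γ γ * D.coroot γ γ ≤ D.form γ γ :=
    Finset.single_le_sum (f := fun β => D.coroot β γ * D.coroot β γ)
      (fun _ _ => mul_self_nonneg _) hγ
  rw [D.coroot_self γ hγ] at this
  linarith

theorem form_root {γ : D.V} (hγ : γ ∈ D.roots) (v : D.V) :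
    2 * D.form γ v = D.coroot γ v * D.form γ γ := by
  have h := D.form_inv (D.srefl γ) γ v
  have h1 : D.act (D.srefl γ) γ = -γ := by
    rw [D.srefl_apply γ hγ, D.coroot_self γ hγ, two_smul]; abel
  rw [h1, D.srefl_apply γ hγ, form_neg_left, form_sub_right, form_smul_right] at h
  linarith

/-- abbreviation for the simple pairing -/
noncomputable def p (i : D.I) : D.V →ₗ[ℚ] ℚ := D.coroot (D.simple i)

theorem p_self (i : D.I) : D.p i (D.simple i) = 2 := D.coroot_self _ (D.simple_mem i)

theorem act_s (i : D.I) (v : D.V) : D.act (D.s i) v = v - D.p i v • D.simple i :=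
  D.srefl_apply _ (D.simple_mem i) v

theorem s_s (i : D.I) (v : D.V) : D.act (D.s i) (D.act (D.s i) v) = v := by
  simp only [act_s, map_sub, map_smul, p_self, smul_eq_mul]
  module

theorem coroot_s (i : D.I) {β : D.V} (hβ : β ∈ D.roots) (v : D.V) :
    D.coroot (D.act (D.s i) β) v = D.coroot β (D.act (D.s i) v) := by
  conv_lhs => rw [← D.s_s i v]
  exact D.coroot_equivariant _ β hβ _

theorem p_zero_symm {i j : D.I} (h : D.p i (D.simple j) = 0) : D.p j (D.simple i) = 0 := by
  have h1 := D.form_root (D.simple_mem i) (D.simple j)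
  have h2 := D.form_root (D.simple_mem j) (D.simple i)
  rw [form_comm] at h2
  change _ = D.p i _ * _ at h1
  change _ = D.p j _ * _ at h2
  have h3 := D.form_pos (D.simple_mem j)
  rw [h] at h1
  have : D.p j (D.simple i) * D.form (D.simple j) (D.simple j) = 0 := by linarith
  rcases mul_eq_zero.1 this with h | h
  · exact h
  · linarith

theorem p_nonpos {i j : D.I} (h : j ≠ i) : D.p i (D.simple j) ≤ 0 := by
  have hr := D.roots_invariant (D.s i) _ (D.simple_mem j)
  have hj : D.coef (D.act (D.s i) (D.simple j)) j = 1 := by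
    simp [act_s, coef_simple, h.symm]
  have hi : D.coef (D.act (D.s i) (D.simple j)) i = - D.p i (D.simple j) := by
    simp [act_s, coef_simple, h]
  rcases D.root_cases hr with hp | hn
  · obtain ⟨n, hn⟩ := D.posRoot_coef hp i
    have : (0:ℚ) ≤ n := n.cast_nonneg
    linarith
  · have := hn j
    linarith

theorem posRoot_mult {i : D.I} {β lam : D.V} (hβ : D.IsPosRoot β)
    (hk : ∀ k, k ≠ i → D.coef β k = 0) (hl : D.IsIntegral lam)
    (h1 : D.p i lam = 1 ∨ D.p i lam = -1) : β = D.simple i := by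
  obtain ⟨n, hn⟩ := D.posRoot_coef hβ i
  have hb : β = (n : ℚ) • D.simple i := by
    conv_lhs => rw [D.posRoot_eq hβ]
    rw [Finset.sum_eq_single i]
    · rw [hn]
    · intro j _ hj; simp [hk j hj]
    · simp
  have hn0 : n ≠ 0 := by
    rintro rfl
    exact D.root_ne_zero hβ.1 (by simpa using hb)
  obtain ⟨m, hm⟩ := hl β hβ
  have h2 := D.form_root hβ.1 lam
  have h3 := D.form_root (D.simple_mem i) lam
  have h4 := D.form_pos (D.simple_mem i)
  change _ = D.p i _ * _ at h3
  have e1 : D.form β lam = n * D.form (D.simple i) lam := by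
    rw [hb, form_comm, form_smul_right, form_comm]
  have e2 : D.form β β = n * (n * D.form (D.simple i) (D.simple i)) := by
    rw [hb, form_smul_right, form_comm, form_smul_right]
  rw [e1, e2, hm] at h2
  have hnq : (n : ℚ) ≠ 0 := by exact_mod_cast hn0
  have h5 : (m : ℚ) * n = D.p i lam := by
    have : (n * D.form (D.simple i) (D.simple i)) * ((m : ℚ) * n - D.p i lam) = 0 := by
      linear_combination (-1) * h2 + n * h3
    rcases mul_eq_zero.1 this with h | h
    · exact absurd h (mul_ne_zero hnq h4.ne')
    · linarith
  have h6 : (n : ℤ) ∣ 1 := by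
    rcases h1 with h1 | h1
    · exact ⟨m, by rw [h1] at h5; have : m * (n:ℤ) = 1 := by exact_mod_cast h5
                   linarith⟩
    · exact ⟨-m, by rw [h1] at h5; have : m * (n:ℤ) = -1 := by exact_mod_cast h5
                    linarith⟩
  have h7 : n = 1 := by
    have := Int.natCast_dvd_natCast.1 (by simpa using h6 : (n : ℤ) ∣ ((1:ℕ) : ℤ))
    exact Nat.dvd_one.1 this
  rw [hb, h7]; simp

theorem posRoot_s {i : D.I} {β lam : D.V} (hβ : D.IsPosRoot β) (hne : β ≠ D.simple i)
    (hl : D.IsIntegral lam) (h1 : D.p i lam = 1 ∨ D.p i lam = -1) :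
    D.IsPosRoot (D.act (D.s i) β) := by
  by_cases h : ∀ k, k ≠ i → D.coef β k = 0
  · exact absurd (D.posRoot_mult hβ h hl h1) hne
  · push Not at h
    obtain ⟨k, hk, hk0⟩ := h
    rcases D.root_cases (D.roots_invariant (D.s i) β hβ.1) with hp | hn
    · exact hp
    · exfalso
      have := hn k
      simp only [act_s, map_sub, map_smul, Finsupp.sub_apply, Finsupp.smul_apply, coef_simple,
        if_neg hk.symm, smul_zero, sub_zero] at this
      obtain ⟨n, hn⟩ := D.posRoot_coef hβ k
      have : (0:ℚ) ≤ n := n.cast_nonneg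
      apply hk0; linarith

theorem s_ne_simple {i : D.I} {β : D.V} (hβ : D.IsPosRoot β) :
    D.act (D.s i) β ≠ D.simple i := by
  intro h
  have h2 : β = - D.simple i := by
    rw [← D.s_s i β, h, act_s, p_self, two_smul]; abel
  obtain ⟨n, hn⟩ := D.posRoot_coef hβ i
  rw [h2] at hn
  simp [coef_simple] at hn
  have : (0:ℚ) ≤ n := n.cast_nonneg
  linarith

theorem pre_s {i : D.I} {lam : D.V} (hl : D.IsPreDominant lam)
    (h1 : D.p i lam = 1 ∨ D.p i lam = -1) : D.IsPreDominant (D.act (D.s i) lam) := by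
  have hi : D.p i (D.act (D.s i) lam) = - D.p i lam := by
    simp [act_s, p_self]; ring
  constructor
  · intro β hβ
    by_cases hne : β = D.simple i
    · subst hne
      change ∃ n : ℤ, D.p i _ = n
      rw [hi]
      rcases h1 with h1 | h1
      · exact ⟨-1, by simp [h1]⟩
      · exact ⟨1, by simp [h1]⟩
    · rw [← D.coroot_s i hβ.1]
      exact hl.1 _ (D.posRoot_s hβ hne hl.1 h1)
  · intro β hβ
    by_cases hne : β = D.simple i
    · subst hne
      change -1 ≤ D.p i _
      rw [hi]
      rcases h1 with h1 | h1 <;> rw [h1] <;> norm_num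
    · rw [← D.coroot_s i hβ.1]
      exact hl.2 _ (D.posRoot_s hβ hne hl.1 h1)

theorem mem_diagram {lam β : D.V} : β ∈ D.diagram lam ↔ D.IsPosRoot β ∧ D.coroot β lam = -1 := by
  simp only [diagram, Finset.mem_filter]
  exact ⟨fun h => h.2, fun h => ⟨h.1.1, h⟩⟩

theorem s_up {i : D.I} {lam : D.V} (h1 : D.p i lam = -1) :
    D.act (D.s i) lam = lam + D.simple i := by
  rw [act_s, h1]; module
theorem s_down {i : D.I} {lam : D.V} (h1 : D.p i lam = 1) :
    D.act (D.s i) lam = lam - D.simple i := by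
  rw [act_s, h1]; module

theorem diagram_step {i : D.I} {lam : D.V} (hl : D.IsPreDominant lam) (h1 : D.p i lam = -1) :
    D.diagram lam = insert (D.simple i)
      ((D.diagram (lam + D.simple i)).image (fun β => D.act (D.s i) β)) := by
  have hi : D.p i (lam + D.simple i) = 1 := by rw [map_add, p_self, h1]; norm_num
  have hpre := D.pre_s hl (Or.inr h1)
  rw [D.s_up h1] at hpre
  ext β
  rw [Finset.mem_insert, Finset.mem_image]
  constructor
  · intro hβ
    rw [mem_diagram] at hβ
    by_cases hne : β = D.simple i
    · exact Or.inl hne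
    · right
      refine ⟨D.act (D.s i) β, ?_, D.s_s i β⟩
      rw [mem_diagram]
      refine ⟨D.posRoot_s hβ.1 hne hl.1 (Or.inr h1), ?_⟩
      rw [D.coroot_s i hβ.1.1, ← D.s_up h1, D.s_s]
      exact hβ.2
  · rintro (rfl | ⟨γ, hγ, rfl⟩)
    · exact D.mem_diagram.2 ⟨D.posRoot_simple i, h1⟩
    · rw [mem_diagram] at hγ ⊢
      have hne : γ ≠ D.simple i := by
        rintro rfl
        have := hγ.2
        change D.p i _ = _ at this
        rw [hi] at this
        norm_num at this
      refine ⟨D.posRoot_s hγ.1 hne hl.1 (Or.inr h1), ?_⟩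
      rw [D.coroot_s i hγ.1.1, D.s_up h1]
      exact hγ.2

theorem simple_not_mem {i : D.I} {mu : D.V} :
    D.simple i ∉ (D.diagram mu).image (fun β => D.act (D.s i) β) := by
  rw [Finset.mem_image]
  rintro ⟨γ, hγ, h⟩
  exact D.s_ne_simple (D.mem_diagram.1 hγ).1 h

theorem card_step {i : D.I} {lam : D.V} (hl : D.IsPreDominant lam) (h1 : D.p i lam = -1) :
    (D.diagram lam).card = (D.diagram (lam + D.simple i)).card + 1 := by
  rw [D.diagram_step hl h1, Finset.card_insert_of_notMem D.simple_not_mem,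
    Finset.card_image_of_injective _ (D.act (D.s i)).injective]

theorem exists_simple {lam β : D.V} (hl : D.IsPreDominant lam) (hβ : β ∈ D.diagram lam) :
    ∃ i, D.p i lam = -1 := by
  by_contra hcon
  push Not at hcon
  rw [mem_diagram] at hβ
  have hnn : ∀ i, 0 ≤ D.p i lam := by
    intro i
    obtain ⟨n, hn⟩ := hl.1 _ (D.posRoot_simple i)
    have h2 := hl.2 _ (D.posRoot_simple i)
    have h3 := hcon i
    change D.p i lam = n at hn
    change -1 ≤ D.p i lam at h2
    rw [hn] at h2 h3 ⊢
    have h2' : -1 ≤ n := by exact_mod_cast h2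
    have h3' : n ≠ -1 := by exact_mod_cast h3
    exact_mod_cast (by omega : 0 ≤ n)
  have h1 := D.form_root hβ.1.1 lam
  have h2 := D.form_pos hβ.1.1
  rw [hβ.2] at h1
  have h3 : 0 ≤ D.form β lam := by
    rw [D.posRoot_eq hβ.1, form_sum_smul]
    refine Finset.sum_nonneg fun i _ => ?_
    obtain ⟨n, hn⟩ := D.posRoot_coef hβ.1 i
    have h4 := D.form_root (D.simple_mem i) lam
    change _ = D.p i lam * _ at h4
    have h5 := mul_nonneg (hnn i) (D.form_pos (D.simple_mem i)).le
    rw [hn]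
    exact mul_nonneg n.cast_nonneg (by linarith)
  linarith

theorem s_add (i : D.I) (u v : D.V) : D.act (D.s i) (u + v) = D.act (D.s i) u + D.act (D.s i) v :=
  map_add _ _ _

theorem root_step (n : ℕ) : ∀ lam : D.V, D.IsPreDominant lam → (D.diagram lam).card = n →
    ∀ β ∈ D.diagram lam, D.IsPreDominant (lam + β) ∧
      ((D.diagram (lam + β)).card : ℚ) + D.hgt β = n := by
  induction n with
  | zero =>
    intro lam _ h0 β hβ
    rw [Finset.card_eq_zero] at h0
    simp [h0] at hβ
  | succ n ih =>
    intro lam hl hc β hβ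
    obtain ⟨i, hi⟩ := D.exists_simple hl hβ
    have hpre : D.IsPreDominant (lam + D.simple i) := D.s_up hi ▸ D.pre_s hl (Or.inr hi)
    have hcard := D.card_step hl hi
    by_cases hne : β = D.simple i
    · subst hne
      refine ⟨hpre, ?_⟩
      rw [hgt_simple, ← hc, hcard]; push_cast; ring
    have hβ' := hβ
    rw [mem_diagram] at hβ'
    have hpos := D.posRoot_s hβ'.1 hne hl.1 (Or.inr hi)
    have hmem : D.act (D.s i) β ∈ D.diagram (lam + D.simple i) := by
      rw [mem_diagram]
      refine ⟨hpos, ?_⟩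
      rw [D.coroot_s i hβ'.1.1, ← D.s_up hi, D.s_s]
      exact hβ'.2
    obtain ⟨h1, h2⟩ := ih _ hpre (by omega) _ hmem
    have hsum : D.act (D.s i) (lam + β) = lam + D.simple i + D.act (D.s i) β := by
      rw [s_add, D.s_up hi]
    have hsum' : D.act (D.s i) (lam + D.simple i + D.act (D.s i) β) = lam + β := by
      rw [← hsum, s_s]
    obtain ⟨m, hm⟩ := D.crystallographic _ (D.simple_mem i) β hβ'.1.1
    change D.p i β = m at hm
    have hpp : D.p i (lam + D.simple i + D.act (D.s i) β) = 1 - m := by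
      rw [act_s, map_add, map_add, map_sub, map_smul, p_self, hi, hm, smul_eq_mul]; ring
    have hh : D.hgt (D.act (D.s i) β) = D.hgt β - m := by
      rw [act_s, hgt_sub, hgt_smul, hgt_simple, hm, mul_one]
    have hm2 : m ≤ 2 := by
      have := h1.2 _ (D.posRoot_simple i)
      change -1 ≤ D.p i _ at this
      rw [hpp] at this
      have : (m : ℚ) ≤ 2 := by linarith
      exact_mod_cast this
    have hm0 : 0 ≤ m := by
      have h3 := hl.2 _ hpos
      rw [D.coroot_s i hβ'.1.1, D.s_up hi, map_add, hβ'.2] at h3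
      have h4 : 0 ≤ D.coroot β (D.simple i) := by linarith
      have h5 := D.form_root hβ'.1.1 (D.simple i)
      have h6 := D.form_root (D.simple_mem i) β
      change _ = D.p i β * _ at h6
      rw [form_comm, h5] at h6
      rw [hm] at h6
      have h7 := mul_nonneg h4 (D.form_pos hβ'.1.1).le
      rw [h6] at h7
      have := nonneg_of_mul_nonneg_left h7 (D.form_pos (D.simple_mem i))
      exact_mod_cast this
    rw [hh] at h2
    have hcases : m = 0 ∨ m = 1 ∨ m = 2 := by omega
    rcases hcases with rfl | rfl | rfl
    · have hp1 : D.p i (lam + D.simple i + D.act (D.s i) β) = 1 := by rw [hpp]; norm_num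
      have hpre2 := D.pre_s h1 (Or.inl hp1)
      rw [hsum'] at hpre2
      refine ⟨hpre2, ?_⟩
      have hq : D.p i (lam + β) = -1 := by rw [map_add, hi, hm]; norm_num
      rw [D.card_step hpre2 hq, ← D.s_up hq, hsum]
      push_cast at h2 ⊢
      linarith
    · have : lam + D.simple i + D.act (D.s i) β = lam + β := by
        rw [act_s, hm]; push_cast; module
      rw [this] at h1 h2
      refine ⟨h1, ?_⟩
      push_cast at h2 ⊢
      linarith
    · have hp1 : D.p i (lam + D.simple i + D.act (D.s i) β) = -1 := by rw [hpp]; norm_num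
      have hpre2 := D.pre_s h1 (Or.inr hp1)
      rw [hsum'] at hpre2
      refine ⟨hpre2, ?_⟩
      have := D.card_step h1 hp1
      rw [← D.s_up hp1, hsum'] at this
      rw [this] at h2
      push_cast at h2 ⊢
      linarith

theorem path_bound : ∀ (l : List D.V) (lam : D.V), D.IsPreDominant lam → D.IsWeightPath lam l →
    D.IsPreDominant (lam + l.sum) ∧
    ((D.diagram (lam + l.sum)).card : ℚ) + (l.map D.hgt).sum = (D.diagram lam).card ∧
    (∀ β ∈ l, D.IsPosRoot β) := by
  intro l
  induction l with
  | nil => intro lam hl _; simpa using hl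
  | cons β l ih =>
    intro lam hl hp
    obtain ⟨hβ, h1, h2⟩ := hp
    have hmem : β ∈ D.diagram lam := D.mem_diagram.2 ⟨hβ, h1⟩
    rw [D.srefl_apply β hβ.1, h1] at h2
    have e : lam - (-1 : ℚ) • β = lam + β := by module
    rw [e] at h2
    obtain ⟨h3, h4⟩ := D.root_step _ lam hl rfl β hmem
    obtain ⟨h5, h6, h7⟩ := ih _ h3 h2
    rw [List.sum_cons, ← add_assoc]
    refine ⟨h5, ?_, ?_⟩
    · rw [List.map_cons, List.sum_cons]; linarith
    · intro γ hγ
      rcases List.mem_cons.1 hγ with rfl | h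
      · exact hβ
      · exact h7 γ h

theorem sum_hgt : ∀ (l : List D.V), (∀ β ∈ l, D.IsPosRoot β) →
    (l.length : ℚ) ≤ (l.map D.hgt).sum ∧
    ((l.map D.hgt).sum ≤ l.length → ∀ β ∈ l, ∃ i, β = D.simple i) := by
  intro l
  induction l with
  | nil => simp
  | cons β l ih =>
    intro h
    obtain ⟨h1, h2⟩ := ih fun γ hγ => h γ (List.mem_cons_of_mem _ hγ)
    obtain ⟨h3, h4⟩ := D.hgt_pos (h β List.mem_cons_self)
    simp only [List.map_cons, List.sum_cons, List.length_cons]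
    push_cast
    refine ⟨by linarith, fun h5 γ hγ => ?_⟩
    rcases List.mem_cons.1 hγ with rfl | hγ
    · exact h4 (by linarith)
    · exact h2 (by linarith) γ hγ

/-- simple steps between pre-dominant weights -/
def Step (mu nu : D.V) : Prop :=
  D.IsPreDominant mu ∧ ∃ i, D.p i mu = -1 ∧ nu = mu + D.simple i

/-- reachability by simple steps -/
def Reach : D.V → D.V → Prop := Relation.ReflTransGen D.Step

theorem Step.pre {mu nu : D.V} (h : D.Step mu nu) : D.IsPreDominant nu := by
  obtain ⟨h, i, hi, rfl⟩ := h
  exact D.s_up hi ▸ D.pre_s h (Or.inr hi)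

theorem reach_pre {mu nu : D.V} (hm : D.IsPreDominant mu) (h : D.Reach mu nu) :
    D.IsPreDominant nu := by
  induction h with
  | refl => exact hm
  | tail _ h _ => exact Step.pre D h

theorem reach_le {mu nu : D.V} {i : D.I} (hm : D.p i mu ≤ 1) (h : D.Reach mu nu) :
    D.p i nu ≤ 1 := by
  induction h with
  | refl => exact hm
  | tail _ h ih =>
    obtain ⟨_, j, hj, rfl⟩ := h
    rw [map_add]
    by_cases hij : j = i
    · subst hij; rw [hj, p_self]; norm_num
    · have := D.p_nonpos hij; linarith

theorem reach_hgt {mu nu : D.V} (h : D.Reach mu nu) : D.hgt mu ≤ D.hgt nu := by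
  induction h with
  | refl => exact le_rfl
  | tail _ h ih =>
    obtain ⟨_, j, hj, rfl⟩ := h
    rw [hgt_add, hgt_simple]; linarith

theorem reach_shift {lam nu : D.V} {i : D.I} (hl : D.IsPreDominant lam) (hi : D.p i lam = -1)
    (h : D.Reach (lam + D.simple i) nu) :
    D.p i nu = 1 → D.Reach lam (nu - D.simple i) := by
  have h0 : D.Reach lam (lam + D.simple i) := Relation.ReflTransGen.single ⟨hl, i, hi, rfl⟩
  have hi1 : D.p i (lam + D.simple i) ≤ 1 := by rw [map_add, p_self, hi]; norm_num
  induction h with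
  | refl => intro _; rw [add_sub_cancel_right]; exact Relation.ReflTransGen.refl
  | @tail rho nu' hr hst ih =>
    obtain ⟨hpr, j, hj, rfl⟩ := hst
    intro h1
    by_cases hij : j = i
    · subst hij
      rw [add_sub_cancel_right]
      exact Relation.ReflTransGen.trans h0 hr
    · have h2 := D.reach_le hi1 hr
      have h3 := D.p_nonpos hij
      rw [map_add] at h1
      have h4 : D.p i rho = 1 := by linarith
      have h5 : D.p i (D.simple j) = 0 := by linarith
      have h6 := ih h4
      refine Relation.ReflTransGen.tail h6 ⟨D.reach_pre hl h6, j, ?_, ?_⟩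
      · rw [map_sub, D.p_zero_symm h5, hj]; norm_num
      · abel

theorem p_ge {lam : D.V} (hl : D.IsPreDominant lam) (i : D.I) : -1 ≤ D.p i lam :=
  hl.2 _ (D.posRoot_simple i)

theorem diamond {lam mu nu : D.V} (h1 : D.Step lam mu) (h2 : D.Step lam nu) :
    ∃ x, Relation.ReflGen D.Step mu x ∧ Relation.ReflTransGen D.Step nu x := by
  have hm := Step.pre D h1
  have hn := Step.pre D h2
  obtain ⟨hl, i, hi, rfl⟩ := h1
  obtain ⟨_, j, hj, rfl⟩ := h2
  by_cases hij : j = i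
  · subst hij; exact ⟨_, Relation.ReflGen.refl, Relation.ReflTransGen.refl⟩
  · have h3 := D.p_ge hn i
    have h4 := D.p_nonpos hij
    rw [map_add, hi] at h3
    have h5 : D.p i (D.simple j) = 0 := by linarith
    have h6 := D.p_zero_symm h5
    refine ⟨lam + D.simple i + D.simple j, Relation.ReflGen.single ⟨hm, j, ?_, rfl⟩,
      Relation.ReflTransGen.single ⟨hn, i, ?_, by abel⟩⟩
    · rw [map_add, h6, hj]; norm_num
    · rw [map_add, h5, hi]; norm_num

theorem terminal_reach {mu nu : D.V} (ht : ∀ i, D.p i mu ≠ -1) (h : D.Reach mu nu) : nu = mu := by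
  rcases Relation.ReflTransGen.cases_head h with h | ⟨c, ⟨_, i, hi, _⟩, _⟩
  · exact h.symm
  · exact absurd hi (ht i)

theorem reach_terminal {lam mu nu : D.V} (h1 : D.Reach lam mu) (h2 : D.Reach lam nu)
    (ht : ∀ i, D.p i nu ≠ -1) : D.Reach mu nu := by
  obtain ⟨x, hx1, hx2⟩ := Relation.church_rosser (fun a b c h1 h2 => D.diamond h1 h2) h1 h2
  rw [D.terminal_reach ht hx2] at hx1
  exact hx1

theorem p_int {lam : D.V} (hl : D.IsPreDominant lam) (i : D.I) : ∃ n : ℤ, D.p i lam = n :=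
  hl.1 _ (D.posRoot_simple i)

theorem main_exists (F : Type) [Field F] [Algebra ℚ F] (n : ℕ) :
    ∀ lam : D.V, D.IsPreDominant lam → (D.diagram lam).card = n →
    ∃ g : D.V → (D.V →ₗ[ℚ] F) → F,
      (∀ mu e, g mu e ≠ 0 → D.Reach lam mu) ∧
      (∀ e, g lam e = ∏ β ∈ D.diagram lam, e β) ∧
      (∀ mu e, D.Reach lam mu → (∀ i, D.p i mu ≠ -1) → g mu e = 1) ∧
      (∀ mu e, e (mu - lam) * g mu e =
        ∑ j, if D.p j mu = 1 then g (mu - D.simple j) e else 0) := by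
  induction n with
  | zero =>
    intro lam hl h0
    rw [Finset.card_eq_zero] at h0
    have ht : ∀ i, D.p i lam ≠ -1 := by
      intro i hi
      have : D.simple i ∈ D.diagram lam := D.mem_diagram.2 ⟨D.posRoot_simple i, hi⟩
      simp [h0] at this
    refine ⟨fun mu _ => if mu = lam then 1 else 0, ?_, ?_, ?_, ?_⟩
    · intro mu e h
      have : mu = lam := by by_contra hh; simp [hh] at h
      rw [this]; exact Relation.ReflTransGen.refl
    · intro e; simp [h0]
    · intro mu e h _
      simp [D.terminal_reach ht h]
    · intro mu e
      have hL : e (mu - lam) * (if mu = lam then (1:F) else 0) = 0 := by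
        split_ifs with h
        · simp [h]
        · simp
      rw [hL]
      symm
      refine Finset.sum_eq_zero fun j _ => ?_
      by_cases h1 : D.p j mu = 1
      · rw [if_pos h1]
        refine if_neg ?_
        intro h2
        apply ht j
        rw [← h2, map_sub, h1, p_self]; norm_num
      · rw [if_neg h1]
  | succ n ih =>
    intro lam hl hc
    obtain ⟨β, hβ⟩ := Finset.card_pos.1 (by omega : 0 < (D.diagram lam).card)
    obtain ⟨i, hi⟩ := D.exists_simple hl hβ
    have hst : D.Step lam (lam + D.simple i) := ⟨hl, i, hi, rfl⟩
    have hr0 : D.Reach lam (lam + D.simple i) := Relation.ReflTransGen.single hst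
    have hcard := D.card_step hl hi
    obtain ⟨G, G1, G2, G3, G4⟩ := ih _ (Step.pre D hst) (by omega)
    let tw : (D.V →ₗ[ℚ] F) → (D.V →ₗ[ℚ] F) := fun e => e.comp (D.act (D.s i)).toLinearMap
    have tw_apply : ∀ e v, tw e v = e (D.act (D.s i) v) := fun e v => rfl
    set a := D.simple i with ha
    have hp1 : D.p i (lam + a) = 1 := by rw [map_add, p_self, hi]; norm_num
    let g : D.V → (D.V →ₗ[ℚ] F) → F := fun mu e =>
      G mu (tw e) + if D.p i mu = -1 then e a * G (mu + a) (tw e) else 0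
    have g_def : ∀ mu e, g mu e =
      G mu (tw e) + if D.p i mu = -1 then e a * G (mu + a) (tw e) else 0 := fun _ _ => rfl
    have supp : ∀ mu e, g mu e ≠ 0 → D.Reach lam mu := by
      intro mu e h
      rw [g_def] at h
      by_cases hG : G mu (tw e) = 0
      · rw [hG, zero_add] at h
        by_cases hm : D.p i mu = -1
        · rw [if_pos hm] at h
          have h2 := G1 _ _ (right_ne_zero_of_mul h)
          have h3 := D.reach_shift hl hi h2 (by rw [map_add, p_self, hm]; norm_num)
          rwa [add_sub_cancel_right] at h3
        · simp [hm] at h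
      · exact Relation.ReflTransGen.trans hr0 (G1 _ _ hG)
    refine ⟨g, supp, ?_, ?_, ?_⟩
    · intro e
      have h0 : G lam (tw e) = 0 := by
        by_contra h
        have := D.reach_hgt (G1 _ _ h)
        rw [hgt_add, hgt_simple] at this
        linarith
      rw [g_def, h0, if_pos hi, zero_add, G2, D.diagram_step hl hi,
        Finset.prod_insert D.simple_not_mem,
        Finset.prod_image (fun x _ y _ h => (D.act (D.s i)).injective h)]
      rfl
    · intro mu e h ht
      rw [g_def, if_neg (ht i), add_zero]
      exact G3 _ _ (D.reach_terminal hr0 h ht) ht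
    · intro mu e
      by_cases hr : D.Reach lam mu
      swap
      · have h0 : g mu e = 0 := by
          by_contra h; exact hr (supp _ _ h)
        rw [h0, mul_zero]
        symm
        refine Finset.sum_eq_zero fun j _ => ?_
        split_ifs with h1
        · by_contra h
          have h2 := supp _ _ h
          apply hr
          refine Relation.ReflTransGen.tail h2 ⟨D.reach_pre hl h2, j, ?_, by abel⟩
          rw [map_sub, h1, p_self]; norm_num
        · rfl
      have hpre := D.reach_pre hl hr
      have hle : D.p i mu ≤ 1 := D.reach_le (by rw [hi]; norm_num) hr
      have hge := D.p_ge hpre i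
      have hcases : D.p i mu = -1 ∨ D.p i mu = 0 ∨ D.p i mu = 1 := by
        obtain ⟨m, hm⟩ := D.p_int hpre i
        rw [hm] at hle hge ⊢
        have h1 : m ≤ 1 := by exact_mod_cast hle
        have h2 : -1 ≤ m := by exact_mod_cast hge
        have : m = -1 ∨ m = 0 ∨ m = 1 := by omega
        rcases this with rfl | rfl | rfl <;> simp
      have hmu := G4 mu (tw e)
      have htw : ∀ v, tw e (v - (lam + a)) = e v - e lam - algebraMap ℚ F (D.p i v) * e a := by
        intro v
        rw [tw_apply, act_s, map_sub (D.p i), hp1, ← ha]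
        simp only [map_sub, map_add, map_smul, Algebra.smul_def]
        simp only [map_one]
        ring
      rw [htw] at hmu
      rcases hcases with hm | hm | hm
      · -- pairing -1
        have hmu2 := G4 (mu + a) (tw e)
        have hq : D.p i (mu + a) = 1 := by rw [map_add, p_self, hm]; norm_num
        rw [htw, hq] at hmu2
        rw [hm] at hmu
        have key : ∀ j, (if D.p j mu = 1 then g (mu - D.simple j) e else 0) =
            (if D.p j mu = 1 then G (mu - D.simple j) (tw e) else 0) +
            e a * ((if D.p j (mu + a) = 1 then G (mu + a - D.simple j) (tw e) else 0) -
              if j = i then G mu (tw e) else 0) := by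
          intro j
          by_cases hij : j = i
          · subst hij
            rw [hm, hq, ← ha]
            norm_num
          · rw [if_neg hij, sub_zero]
            have h4 := D.p_nonpos hij
            by_cases h5 : D.p i (D.simple j) = 0
            · have h6 := D.p_zero_symm h5
              rw [← ha] at h6
              rw [map_add, h6, add_zero]
              split_ifs with h7
              · have : D.p i (mu - D.simple j) = -1 := by rw [map_sub, h5, hm]; norm_num
                rw [g_def, if_pos this]
                congr 3; abel
              · simp
            · have h7 : D.p i (mu - D.simple j) ≠ -1 := by
                rw [map_sub, hm]; intro h; apply h5; linarith
              have h8 : G (mu + a - D.simple j) (tw e) = 0 := by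
                by_contra h
                have := D.reach_le hp1.le (G1 _ _ h)
                rw [map_sub, hq] at this
                apply h5; linarith
              rw [h8, g_def, if_neg h7]
              simp
        rw [Finset.sum_congr rfl fun j _ => key j, Finset.sum_add_distrib, ← Finset.mul_sum,
          Finset.sum_sub_distrib, ← hmu, ← hmu2, Finset.sum_ite_eq' , if_pos (Finset.mem_univ _),
          g_def, if_pos hm, map_add e, map_sub]
        simp only [map_neg, map_one]
        ring
      · rw [hm] at hmu
        have key : ∀ j, (if D.p j mu = 1 then g (mu - D.simple j) e else 0) =
            (if D.p j mu = 1 then G (mu - D.simple j) (tw e) else 0) := by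
          intro j
          split_ifs with h1
          · have hij : j ≠ i := by rintro rfl; rw [hm] at h1; norm_num at h1
            have h4 := D.p_nonpos hij
            have : D.p i (mu - D.simple j) ≠ -1 := by
              rw [map_sub, hm]; intro h; linarith
            rw [g_def, if_neg this, add_zero]
          · rfl
        rw [Finset.sum_congr rfl fun j _ => key j, ← hmu, g_def, hm, map_sub]
        norm_num
      · rw [hm] at hmu
        have key : ∀ j, (if D.p j mu = 1 then g (mu - D.simple j) e else 0) =
            (if D.p j mu = 1 then G (mu - D.simple j) (tw e) else 0) +
            if j = i then e a * G mu (tw e) else 0 := by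
          intro j
          by_cases hij : j = i
          · subst hij
            have : D.p j (mu - a) = -1 := by rw [map_sub, hm, p_self]; norm_num
            rw [if_pos hm, if_pos hm, if_pos rfl, ← ha, g_def, if_pos this, sub_add_cancel]
          · rw [if_neg hij, add_zero]
            have h4 := D.p_nonpos hij
            have : D.p i (mu - D.simple j) ≠ -1 := by
              rw [map_sub, hm]; intro h; linarith
            rw [g_def, if_neg this, add_zero]
        rw [Finset.sum_congr rfl fun j _ => key j, Finset.sum_add_distrib, ← hmu,
          Finset.sum_ite_eq', if_pos (Finset.mem_univ _), g_def, hm, map_sub]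
        norm_num
        ring

theorem path_snoc : ∀ (l : List D.V) (lam β : D.V), D.IsWeightPath lam (l ++ [β]) ↔
    D.IsWeightPath lam l ∧ D.IsPosRoot β ∧ D.coroot β (lam + l.sum) = -1 := by
  intro l
  induction l with
  | nil => intro lam β; simp [IsWeightPath]
  | cons γ l ih =>
    intro lam β
    simp only [List.cons_append, IsWeightPath, ih, List.sum_cons]
    constructor
    · rintro ⟨h1, h2, h3, h4, h5⟩
      refine ⟨⟨h1, h2, h3⟩, h4, ?_⟩
      rw [D.srefl_apply γ h1.1, h2] at h5
      rw [← h5]; congr 1; module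
    · rintro ⟨⟨h1, h2, h3⟩, h4, h5⟩
      refine ⟨h1, h2, h3, h4, ?_⟩
      have e : lam - (-1 : ℚ) • γ + l.sum = lam + (γ + l.sum) := by module
      rw [D.srefl_apply γ h1.1, h2, e, h5]

theorem pathTerm_snoc {F : Type} [Field F] [Algebra ℚ F] (emb : D.V →ₗ[ℚ] F)
    (l : List D.V) (β : D.V) :
    D.pathTerm emb (l ++ [β]) = D.pathTerm emb l * (emb (l.sum + β))⁻¹ := by
  unfold pathTerm
  rw [List.length_append, List.length_singleton, Finset.prod_range_succ]
  congr 1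
  · refine Finset.prod_congr rfl fun j hj => ?_
    rw [Finset.mem_range] at hj
    rw [List.take_append_of_le_length (by omega)]
  · rw [List.take_of_length_le (by simp)]
    simp

/-- simple paths of length `k` from `lam` to `mu` -/
noncomputable def pset (lam : D.V) : ℕ → D.V → Finset (List D.V)
  | 0, mu => if mu = lam then {[]} else ∅
  | k + 1, mu => (Finset.univ.filter fun j => D.p j mu = 1).biUnion fun j =>
      (pset lam k (mu - D.simple j)).image fun l => l ++ [D.simple j]

theorem mem_pset (lam : D.V) : ∀ (k : ℕ) (mu : D.V) (l : List D.V),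
    l ∈ D.pset lam k mu ↔ l.length = k ∧ (∀ β ∈ l, ∃ i, β = D.simple i) ∧
      D.IsWeightPath lam l ∧ lam + l.sum = mu := by
  intro k
  induction k with
  | zero =>
    intro mu l
    rw [pset]
    constructor
    · intro h
      split_ifs at h with hm
      · rw [Finset.mem_singleton] at h
        subst h; simp [IsWeightPath, hm]
      · simp at h
    · rintro ⟨h1, _, _, h4⟩
      rw [List.length_eq_zero_iff] at h1
      subst h1
      simp at h4
      simp [h4]
  | succ k ih =>
    intro mu l
    simp only [pset, Finset.mem_biUnion, Finset.mem_filter, Finset.mem_univ, true_and,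
      Finset.mem_image, ih]
    constructor
    · rintro ⟨j, hj, l', ⟨h1, h2, h3, h4⟩, rfl⟩
      refine ⟨by simp [h1], ?_, ?_, ?_⟩
      · intro β hβ
        rcases List.mem_append.1 hβ with h | h
        · exact h2 β h
        · exact ⟨j, by simpa using h⟩
      · rw [path_snoc]
        refine ⟨h3, D.posRoot_simple j, ?_⟩
        change D.p j _ = _
        rw [h4, map_sub, hj, p_self]; norm_num
      · rw [List.sum_append, ← add_assoc, h4]; simp
    · rintro ⟨h1, h2, h3, h4⟩
      rcases List.eq_nil_or_concat l with rfl | ⟨l', β, rfl⟩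
      · simp at h1
      · rw [List.concat_eq_append] at *
        obtain ⟨j, rfl⟩ := h2 β (by simp)
        rw [path_snoc] at h3
        obtain ⟨h5, _, h6⟩ := h3
        change D.p j _ = _ at h6
        simp only [List.sum_append, List.sum_singleton] at h4
        rw [← add_assoc] at h4
        refine ⟨j, ?_, l', ⟨by simpa using h1, fun γ hγ => h2 γ (by simp [hγ]), h5, ?_⟩, rfl⟩
        · rw [← h4, map_add, h6, p_self]; norm_num
        · rw [← h4, add_sub_cancel_right]

theorem pset_sum {F : Type} [Field F] [Algebra ℚ F] (emb : D.V →ₗ[ℚ] F) (lam : D.V) (k : ℕ)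
    (mu : D.V) : ∑ l ∈ D.pset lam (k + 1) mu, D.pathTerm emb l =
      (emb (mu - lam))⁻¹ * ∑ j, if D.p j mu = 1 then
        ∑ l ∈ D.pset lam k (mu - D.simple j), D.pathTerm emb l else 0 := by
  rw [pset, Finset.sum_biUnion, ← Finset.sum_filter, Finset.mul_sum]
  · refine Finset.sum_congr rfl fun j _ => ?_
    rw [Finset.sum_image (fun x _ y _ h => List.append_cancel_right h), Finset.mul_sum]
    refine Finset.sum_congr rfl fun l hl => ?_
    rw [mem_pset] at hl
    have : l.sum + D.simple j = mu - lam := by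
      have := hl.2.2.2
      rw [eq_sub_iff_add_eq] at this
      rw [← this]; abel
    rw [pathTerm_snoc, this, mul_comm]
  · intro i _ j _ hij
    refine Finset.disjoint_left.2 fun l h1 h2 => hij ?_
    obtain ⟨x, _, rfl⟩ := Finset.mem_image.1 h1
    obtain ⟨y, _, h⟩ := Finset.mem_image.1 h2
    have := (List.append_inj' h rfl).2
    simp only [List.cons.injEq, and_true] at this
    exact (D.simple_indep.injective this).symm

theorem exists_terminal (n : ℕ) : ∀ lam : D.V, D.IsPreDominant lam → (D.diagram lam).card = n →
    ∃ mu, D.Reach lam mu ∧ (∀ i, D.p i mu ≠ -1) ∧ D.hgt (mu - lam) = n := by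
  induction n with
  | zero =>
    intro lam hl h0
    rw [Finset.card_eq_zero] at h0
    refine ⟨lam, Relation.ReflTransGen.refl, ?_, by simp [hgt]⟩
    intro i hi
    have : D.simple i ∈ D.diagram lam := D.mem_diagram.2 ⟨D.posRoot_simple i, hi⟩
    simp [h0] at this
  | succ n ih =>
    intro lam hl hc
    obtain ⟨β, hβ⟩ := Finset.card_pos.1 (by omega : 0 < (D.diagram lam).card)
    obtain ⟨i, hi⟩ := D.exists_simple hl hβ
    have hst : D.Step lam (lam + D.simple i) := ⟨hl, i, hi, rfl⟩
    have hcard := D.card_step hl hi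
    obtain ⟨mu, h1, h2, h3⟩ := ih _ (Step.pre D hst) (by omega)
    refine ⟨mu, Relation.ReflTransGen.head hst h1, h2, ?_⟩
    rw [hgt_sub, hgt_add, hgt_simple] at h3
    rw [hgt_sub]
    push_cast
    linarith

theorem path_reach : ∀ (l : List D.V) (lam : D.V), D.IsPreDominant lam →
    (∀ β ∈ l, ∃ i, β = D.simple i) → D.IsWeightPath lam l → D.Reach lam (lam + l.sum) := by
  intro l
  induction l with
  | nil => 
    intro lam _ _ _
    rw [List.sum_nil, add_zero]
    exact Relation.ReflTransGen.refl
  | cons β l ih =>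
    intro lam hl hs hp
    obtain ⟨i, rfl⟩ := hs β List.mem_cons_self
    obtain ⟨h0, h1, h2⟩ := hp
    change D.IsWeightPath (D.act (D.s i) lam) l at h2
    rw [D.s_up h1] at h2
    have hst : D.Step lam (lam + D.simple i) := ⟨hl, i, h1, rfl⟩
    have := ih _ (Step.pre D hst) (fun γ hγ => hs γ (List.mem_cons_of_mem _ hγ)) h2
    rw [List.sum_cons, ← add_assoc]
    exact Relation.ReflTransGen.head hst this

end WeylSetting

/-- For a pre-dominant integral weight `λ` with `d = |D(λ)|`: every `λ`-path has
length at most `d`; every `λ`-path of length `d` consists of simple roots; and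
the sum of the path products over all maximal `λ`-paths equals `∏_{β ∈ D(λ)} 1/β`. -/
theorem nakada_lowest_degree
    (D : WeylSetting) (lam : D.V) (hlam : D.IsPreDominant lam)
    (F : Type) [Field F] [Algebra ℚ F] (emb : D.V →ₗ[ℚ] F)
    (hemb : Function.Injective emb) :
    (∀ l : List D.V, D.IsWeightPath lam l → l.length ≤ (D.diagram lam).card) ∧
    (∀ l : List D.V, D.IsWeightPath lam l → l.length = (D.diagram lam).card →
        ∀ β ∈ l, ∃ i, β = D.simple i) ∧
    (∑ᶠ l : List D.V,
        if D.IsWeightPath lam l ∧ l.length = (D.diagram lam).card then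
          D.pathTerm emb l else 0) =
      ∏ β ∈ D.diagram lam, (emb β)⁻¹ := by
  have part1 : ∀ l : List D.V, D.IsWeightPath lam l → l.length ≤ (D.diagram lam).card := by
    intro l hl
    obtain ⟨_, h2, h3⟩ := D.path_bound l lam hlam hl
    have h4 := (D.sum_hgt l h3).1
    have h5 : (0:ℚ) ≤ (D.diagram (lam + l.sum)).card := Nat.cast_nonneg _
    exact_mod_cast (by linarith : (l.length : ℚ) ≤ (D.diagram lam).card)
  have part2 : ∀ l : List D.V, D.IsWeightPath lam l → l.length = (D.diagram lam).card →
        (∀ β ∈ l, ∃ i, β = D.simple i) ∧ D.diagram (lam + l.sum) = ∅ := by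
    intro l hl hd
    obtain ⟨_, h2, h3⟩ := D.path_bound l lam hlam hl
    have h4 := D.sum_hgt l h3
    have h5 : (0:ℚ) ≤ (D.diagram (lam + l.sum)).card := Nat.cast_nonneg _
    rw [← hd] at h2
    refine ⟨h4.2 (by linarith), ?_⟩
    rw [← Finset.card_eq_zero]
    have h6 := h4.1
    exact_mod_cast (by linarith : ((D.diagram (lam + l.sum)).card : ℚ) = 0)
  refine ⟨part1, fun l h1 h2 => (part2 l h1 h2).1, ?_⟩
  obtain ⟨g, g1, g2, g3, g4⟩ := D.main_exists F _ lam hlam rfl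
  obtain ⟨Lam, hL1, hL2, hL3⟩ := D.exists_terminal _ lam hlam rfl
  have hsum : ∀ k : ℕ, ∀ mu, D.hgt (mu - lam) = k →
      (∑ l ∈ D.pset lam k mu, D.pathTerm emb l) * g lam emb = g mu emb := by
    intro k
    induction k with
    | zero =>
      intro mu hk
      rw [WeylSetting.pset]
      split_ifs with h
      · simp [h, WeylSetting.pathTerm]
      · rw [Finset.sum_empty, zero_mul]
        by_contra hne
        have hr := g1 _ _ (Ne.symm hne)
        rcases Relation.ReflTransGen.cases_head hr with h' | ⟨c, ⟨_, i, _, rfl⟩, h'⟩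
        · exact h h'.symm
        · have := D.reach_hgt h'
          rw [D.hgt_add, D.hgt_simple] at this
          rw [D.hgt_sub] at hk
          push_cast at hk
          linarith
    | succ k ih =>
      intro mu hk
      have hne : emb (mu - lam) ≠ 0 := by
        intro h
        have : mu - lam = 0 := hemb (by rw [h, map_zero])
        rw [this] at hk
        simp only [WeylSetting.hgt, map_zero, Finsupp.zero_apply, Finset.sum_const_zero] at hk
        have : (0:ℚ) ≤ k := k.cast_nonneg
        push_cast at hk
        linarith
      rw [D.pset_sum, mul_assoc, Finset.sum_mul, inv_mul_eq_iff_eq_mul₀ hne, g4]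
      refine Finset.sum_congr rfl fun j _ => ?_
      split_ifs with hj
      · apply ih
        rw [D.hgt_sub, D.hgt_sub, D.hgt_simple]
        rw [D.hgt_sub] at hk
        push_cast at hk
        linarith
      · simp
  have hfin : (∑ᶠ l : List D.V,
        if D.IsWeightPath lam l ∧ l.length = (D.diagram lam).card then
          D.pathTerm emb l else 0) =
      ∑ l ∈ D.pset lam (D.diagram lam).card Lam, D.pathTerm emb l := by
    have hiff : ∀ l, (D.IsWeightPath lam l ∧ l.length = (D.diagram lam).card) ↔
        l ∈ D.pset lam (D.diagram lam).card Lam := by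
      intro l
      rw [D.mem_pset]
      constructor
      · rintro ⟨h1, h2⟩
        obtain ⟨h3, h4⟩ := part2 l h1 h2
        refine ⟨h2, h3, h1, ?_⟩
        have hr := D.path_reach l lam hlam h3 h1
        have := D.reach_terminal hr hL1 hL2
        refine (D.terminal_reach ?_ this).symm
        intro i hi
        have : D.simple i ∈ D.diagram (lam + l.sum) :=
          D.mem_diagram.2 ⟨D.posRoot_simple i, hi⟩
        simp [h4] at this
      · rintro ⟨h1, _, h2, _⟩
        exact ⟨h2, h1⟩
    rw [finsum_eq_finsetSum_of_support_subset (s := D.pset lam (D.diagram lam).card Lam)]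
    · refine Finset.sum_congr rfl fun l hl => ?_
      rw [if_pos ((hiff l).2 hl)]
    · intro l hl
      rw [Function.mem_support] at hl
      have : D.IsWeightPath lam l ∧ l.length = (D.diagram lam).card := by
        by_contra h; simp [h] at hl
      exact (hiff l).1 this
  have h1 := hsum _ Lam hL3
  rw [g3 _ _ hL1 hL2, g2] at h1
  rw [hfin, Finset.prod_inv_distrib]
  exact eq_inv_of_mul_eq_one_left h1
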